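/- Let a ≥ 0 and x ≥ 0 be integers, and let B ~ Binomial(x, 1/2). Then Var((a + B)²) = (x/8) · (2(2a + x)² + x − 1). -/

import Mathlib

open MeasureTheory ProbabilityTheory

/-- The distribution of a `Binomial(n, 1/2)` random variable, as a measure on `ℕ`. -/
noncomputable def binomHalf (n : ℕ) : Measure ℕ :=
  ((PMF.binomial (1/2) (by norm_num) n).map Fin.val).toMeasure

instance (n : ℕ) : IsProbabilityMeasure (binomHalf n) := by
  unfold binomHalf; infer_instance

theorem binomHalf_eq_map (n : ℕ) :
    binomHalf n = (PMF.binomial (1/2) (by norm_num) n).toMeasure.map Fin.val :=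
  (PMF.toMeasure_map (f := Fin.val) _ (measurable_of_finite _)).symm

theorem integral_binomHalf (n : ℕ) (f : ℕ → ℝ) :
    ∫ k, f k ∂binomHalf n = (∑ k ∈ Finset.range (n + 1), (n.choose k : ℝ) * f k) / 2 ^ n := by
  rw [binomHalf_eq_map, integral_map (measurable_of_finite _).aemeasurable
    (measurable_of_countable f).aestronglyMeasurable, PMF.integral_eq_sum,
    Finset.sum_range, Finset.sum_div]
  refine Finset.sum_congr rfl fun k _ ↦ ?_
  have hk : (k : ℕ) + (n - k) = n := by have := k.2; omega
  simp [PMF.binomial_apply]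
  rw [← mul_inv, ← pow_add, hk]
  ring

theorem memLp_binomHalf (n : ℕ) (f : ℕ → ℝ) (p : ENNReal) : MemLp f p (binomHalf n) := by
  rw [binomHalf_eq_map, memLp_map_measure_iff (measurable_of_countable f).aestronglyMeasurable
    (measurable_of_finite _).aemeasurable]
  exact MemLp.of_discrete

theorem sum_range_choose_succ_mul (n : ℕ) (f : ℕ → ℝ) :
    ∑ k ∈ Finset.range (n + 2), ((n + 1).choose k : ℝ) * f k =
      ∑ k ∈ Finset.range (n + 1), (n.choose k : ℝ) * f k +
        ∑ k ∈ Finset.range (n + 1), (n.choose k : ℝ) * f (k + 1) :=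
  Finset.sum_choose_succ_mul (fun i _ ↦ f i) n

theorem sum_range_choose_mul_add_sq (n : ℕ) (c : ℝ) :
    ∑ k ∈ Finset.range (n + 1), (n.choose k : ℝ) * (c + k) ^ 2 =
      2 ^ n * ((c + n / 2) ^ 2 + n / 4) := by
  induction n generalizing c with
  | zero => simp
  | succ n ih =>
    rw [sum_range_choose_succ_mul n (fun k ↦ (c + k) ^ 2), ih]
    have h := ih (c + 1)
    simp only [Nat.cast_add, Nat.cast_one, add_assoc, add_comm (1 : ℝ)] at h ⊢
    rw [h]
    ring

theorem sum_range_choose_mul_add_pow_four (n : ℕ) (c : ℝ) :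
    ∑ k ∈ Finset.range (n + 1), (n.choose k : ℝ) * (c + k) ^ 4 =
      2 ^ n * ((c + n / 2) ^ 4 + 3 * n / 2 * (c + n / 2) ^ 2 + (3 * n ^ 2 - 2 * n) / 16) := by
  induction n generalizing c with
  | zero => simp
  | succ n ih =>
    rw [sum_range_choose_succ_mul n (fun k ↦ (c + k) ^ 4), ih]
    have h := ih (c + 1)
    simp only [Nat.cast_add, Nat.cast_one, add_assoc, add_comm (1 : ℝ)] at h ⊢
    rw [h]
    ring

/-- **Variance of `(a + B)²`.** For integers `a ≥ 0`, `x ≥ 0` and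
`B ~ Binomial(x, 1/2)`, `Var((a + B)²) = (x/8)(2(2a + x)² + x - 1)`. -/
theorem statement_18 (a x : ℕ) :
    variance (fun k => ((a + k : ℕ) : ℝ)^2) (binomHalf x) =
      ((x : ℝ) / 8) * (2 * (2*(a : ℝ) + x)^2 + x - 1) := by
  rw [variance_eq_sub (memLp_binomHalf x _ 2)]
  simp only [Pi.pow_apply, ← pow_mul, Nat.cast_add, Nat.reduceMul]
  rw [integral_binomHalf, integral_binomHalf, sum_range_choose_mul_add_sq,
    sum_range_choose_mul_add_pow_four, mul_div_cancel_left₀ _ (by positivity),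
    mul_div_cancel_left₀ _ (by positivity)]
  ring
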